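/- Let f be a Schwartz function on ℝⁿ, let a > 0 be a sampling step, let χ̂ ∈ L^∞(ℝⁿ) be compactly supported, and set χ := inverse Fourier transform of (ξ ↦ π^{−n} χ̂(ξ)) composed so that χ(x) = (2π)^{−n} π^{−n} ∫ e^{i x·ξ} χ̂(ξ) dξ·πⁿ, i.e. χ = (2π)^{−n} ∫ e^{i x·ξ} χ̂(ξ) dξ. Then for every x ∈ ℝⁿ the (absolutely convergent) sampling series satisfies: Σ_{k∈ℤⁿ} f(ak) χ(π(x−ak)/a) = (2π)^{−n} ∫ e^{i x·ξ} π^{−n} χ̂(aξ/π) [Σ_{k∈ℤⁿ} f̂(ξ + (2π/a)k)] dξ = Σ_{k∈ℤⁿ} e^{2πi k·x/a} · F^{−1}[ ξ ↦ π^{−n} χ̂(aξ/π + 2k) f̂(ξ) ](x). That is, reconstruction from samples at step a with filter χ produces the filtered periodization of f̂ (folding of frequencies), and it decomposes as a sum over k ∈ ℤⁿ of the modulation e^{2πi k·x/a} composed with the Fourier multiplier with symbol π^{−n} χ̂(aξ/π + 2k). -/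

import Mathlib

open MeasureTheory Complex SchwartzMap

/-- The Euclidean pairing `x·ξ = ∑ xʲξⱼ` on `ℝⁿ`. -/
noncomputable def dotp {n : ℕ} (x ξ : Fin n → ℝ) : ℝ := ∑ j, x j * ξ j

/-- The Fourier transform `f̂(ξ) = ∫ e^{−i x·ξ} f(x) dx` on `ℝⁿ`. -/
noncomputable def FTn {n : ℕ} (f : (Fin n → ℝ) → ℂ) (ξ : Fin n → ℝ) : ℂ :=
  ∫ x : Fin n → ℝ, Complex.exp (((-(dotp x ξ) : ℝ) : ℂ) * Complex.I) * f x

/-- The inverse Fourier transform `F⁻¹[g](x) = (2π)^{−n} ∫ e^{i x·ξ} g(ξ) dξ` on `ℝⁿ`. -/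
noncomputable def invFTn {n : ℕ} (g : (Fin n → ℝ) → ℂ) (x : Fin n → ℝ) : ℂ :=
  ((2 * Real.pi) ^ n)⁻¹ • ∫ ξ : Fin n → ℝ, Complex.exp ((dotp x ξ : ℂ) * Complex.I) * g ξ

/-- The integer vector `k` seen in `ℝⁿ`. -/
def intVec {n : ℕ} (k : Fin n → ℤ) : Fin n → ℝ := fun j => (k j : ℝ)

lemma intVec_add {n : ℕ} (k l : Fin n → ℤ) : intVec (k + l) = intVec k + intVec l := by
  ext j; simp [intVec]

/-- The half-open unit cube `(0, 1]ⁿ`. -/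
def unitBox (n : ℕ) : Set (Fin n → ℝ) := {x | ∀ j, x j ∈ Set.Ioc (0 : ℝ) (0 + 1)}

lemma unitBox_eq_pi (n : ℕ) : unitBox n = Set.univ.pi fun _ => Set.Ioc (0 : ℝ) (0 + 1) := by
  ext x; simp [unitBox]

lemma measurableSet_unitBox (n : ℕ) : MeasurableSet (unitBox n) := by
  rw [unitBox_eq_pi]
  exact MeasurableSet.univ_pi fun _ => measurableSet_Ioc

lemma volume_unitBox (n : ℕ) : volume (unitBox n) = 1 := by
  rw [unitBox_eq_pi, volume_pi_pi]
  simp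

lemma norm_le_one_of_mem_unitBox {n : ℕ} {x : Fin n → ℝ} (hx : x ∈ unitBox n) : ‖x‖ ≤ 1 := by
  refine (pi_norm_le_iff_of_nonneg zero_le_one).2 fun j => ?_
  have := hx j
  rw [Real.norm_eq_abs, abs_le]
  constructor <;> linarith [this.1, this.2]

/-- The integral over `ℝⁿ` is the sum over `ℤⁿ` of the integrals of translates over the unit
cube. -/
lemma hasSum_integral_unitBox {n : ℕ} {E : Type*} [NormedAddCommGroup E] [NormedSpace ℝ E]
    {g : (Fin n → ℝ) → E} (hg : Integrable g) :
    HasSum (fun k : Fin n → ℤ => ∫ x in unitBox n, g (x + intVec k)) (∫ x, g x) := by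
  have hU : (⋃ k : Fin n → ℤ, (fun x => x - intVec k) ⁻¹' unitBox n) = Set.univ := by
    refine Set.eq_univ_of_forall fun x => Set.mem_iUnion.2 ⟨fun j => ⌈x j⌉ - 1, fun j => ?_⟩
    simp only [Pi.sub_apply, intVec, Int.cast_sub, Int.cast_one, Set.mem_Ioc]
    constructor <;> linarith [Int.ceil_lt_add_one (x j), Int.le_ceil (x j)]
  have hD : Pairwise fun k l : Fin n → ℤ =>
      Disjoint ((fun x => x - intVec k) ⁻¹' unitBox n) ((fun x => x - intVec l) ⁻¹' unitBox n) := by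
    intro k l hkl
    refine Set.disjoint_left.2 fun x hk hl => hkl (funext fun j => ?_)
    have h1 := hk j
    have h2 := hl j
    simp only [Pi.sub_apply, intVec, Set.mem_Ioc] at h1 h2
    have h3 : (k j : ℝ) < l j + 1 := by linarith
    have h4 : (l j : ℝ) < k j + 1 := by linarith
    norm_cast at h3 h4
    omega
  have hM : ∀ k : Fin n → ℤ, MeasurableSet ((fun x => x - intVec k) ⁻¹' unitBox n) := fun k =>
    (measurableSet_unitBox n).preimage (by fun_prop)
  have := hasSum_integral_iUnion hM hD hg.integrableOn
  rw [hU, setIntegral_univ] at this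
  convert! this using 2 with k
  rw [← (measurePreserving_add_right volume (intVec k)).setIntegral_preimage_emb
    (measurableEmbedding_addRight _) g]
  congr 2
  ext x; simp

/-- The decaying weight `(1 + ‖x‖)^{-(n+1)}`, integrable on `ℝⁿ`. -/
noncomputable def decayWeight {n : ℕ} (x : Fin n → ℝ) : ℝ := ((1 + ‖x‖) ^ (n + 1))⁻¹

lemma decayWeight_nonneg {n : ℕ} (x : Fin n → ℝ) : 0 ≤ decayWeight x := by
  unfold decayWeight; positivity

lemma decayWeight_le {n : ℕ} {x y : Fin n → ℝ} {K : ℝ}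
    (h : 1 + ‖y‖ ≤ K * (1 + ‖x‖)) : decayWeight x ≤ K ^ (n + 1) * decayWeight y := by
  unfold decayWeight
  rw [← div_eq_mul_inv, inv_eq_one_div, div_le_div_iff₀ (by positivity) (by positivity), one_mul,
    ← mul_pow]
  gcongr

lemma integrable_decayWeight (n : ℕ) : Integrable (decayWeight : (Fin n → ℝ) → ℝ) := by
  have := integrable_one_add_norm (E := Fin n → ℝ) (μ := volume) (r := (n + 1 : ℕ)) (by simp)
  refine this.congr (.of_forall fun x => ?_)
  simp only [decayWeight]
  rw [Real.rpow_neg (by positivity), Real.rpow_natCast]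

lemma summable_decayWeight (n : ℕ) : Summable fun k : Fin n → ℤ => decayWeight (intVec k) := by
  refine Summable.of_nonneg_of_le (fun k => decayWeight_nonneg _) (fun k => ?_)
    ((hasSum_integral_unitBox (integrable_decayWeight n)).summable.mul_left (2 ^ (n + 1)))
  have h1 : decayWeight (intVec k) = ∫ x in unitBox n, decayWeight (intVec k) := by
    simp [measureReal_def, volume_unitBox]
  rw [h1, ← integral_const_mul]
  refine setIntegral_mono_on ?_ ?_ (measurableSet_unitBox n) fun x hx => ?_
  · exact integrableOn_const (by simp [volume_unitBox])
  · exact (((integrable_decayWeight n).comp_add_right _).const_mul _).integrableOn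
  · refine decayWeight_le ?_
    have := norm_le_one_of_mem_unitBox hx
    have := norm_add_le x (intVec k)
    linarith [norm_nonneg (intVec k)]

lemma decayWeight_add_smul_le {n : ℕ} {c R : ℝ} (hc : 0 < c) (hR : 0 ≤ R) {x y : Fin n → ℝ}
    (hx : ‖x‖ ≤ R) :
    decayWeight (x + c • y) ≤ (1 + (1 + R) / c) ^ (n + 1) * decayWeight y := by
  refine decayWeight_le ?_
  have h1 : c * ‖y‖ ≤ ‖x + c • y‖ + R := by
    have : c • y = (x + c • y) - x := by abel
    calc c * ‖y‖ = ‖c • y‖ := by rw [norm_smul, Real.norm_of_nonneg hc.le]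
      _ ≤ ‖x + c • y‖ + ‖x‖ := by
        conv_lhs => rw [this]
        exact norm_sub_le _ _
      _ ≤ _ := by gcongr
  have h2 : ‖y‖ ≤ (‖x + c • y‖ + R) / c := by
    rw [le_div_iff₀ hc]; linarith
  have h3 : (‖x + c • y‖ + R) / c ≤ (1 + R) / c * (1 + ‖x + c • y‖) := by
    rw [div_mul_eq_mul_div]
    gcongr
    nlinarith [norm_nonneg (x + c • y)]
  nlinarith [norm_nonneg (x + c • y)]

/-- `g` is bounded by a multiple of an integrable weight. -/
def HasDecay {n : ℕ} (g : (Fin n → ℝ) → ℂ) : Prop := ∃ C, 0 ≤ C ∧ ∀ x, ‖g x‖ ≤ C * decayWeight x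

lemma HasDecay.integrable {n : ℕ} {g : (Fin n → ℝ) → ℂ} (hd : HasDecay g) (hg : Continuous g) :
    Integrable g := by
  obtain ⟨C, -, hC⟩ := hd
  exact ((integrable_decayWeight n).const_mul C).mono' hg.aestronglyMeasurable (.of_forall hC)

lemma HasDecay.exists_bound {n : ℕ} {g : (Fin n → ℝ) → ℂ} (hd : HasDecay g) {c : ℝ} (hc : 0 < c)
    {R : ℝ} (hR : 0 ≤ R) : ∃ C, 0 ≤ C ∧
      ∀ x, ‖x‖ ≤ R → ∀ k, ‖g (x + c • intVec k)‖ ≤ C * decayWeight (intVec k) := by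
  obtain ⟨C, hC0, hC⟩ := hd
  refine ⟨C * (1 + (1 + R) / c) ^ (n + 1), by positivity, fun x hx k => (hC _).trans ?_⟩
  rw [mul_assoc]
  gcongr
  exact decayWeight_add_smul_le hc hR hx

lemma HasDecay.summable {n : ℕ} {g : (Fin n → ℝ) → ℂ} (hd : HasDecay g) {c : ℝ} (hc : 0 < c)
    (x : Fin n → ℝ) : Summable fun k => g (x + c • intVec k) := by
  obtain ⟨C, -, hC⟩ := hd.exists_bound hc (norm_nonneg x)
  exact .of_norm_bounded ((summable_decayWeight n).mul_left C) (hC x le_rfl)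

lemma HasDecay.continuous_tsum {n : ℕ} {g : (Fin n → ℝ) → ℂ} (hd : HasDecay g)
    (hg : Continuous g) {c : ℝ} (hc : 0 < c) :
    Continuous fun x => ∑' k, g (x + c • intVec k) := by
  refine continuous_iff_continuousAt.2 fun x => ?_
  obtain ⟨C, -, hC⟩ := hd.exists_bound hc (R := ‖x‖ + 1) (by positivity)
  have : ContinuousOn (fun x => ∑' k, g (x + c • intVec k)) (Metric.ball 0 (‖x‖ + 1)) :=
    continuousOn_tsum (fun k => by fun_prop) ((summable_decayWeight n).mul_left C)
      fun k y hy => hC y (by simpa using (Metric.mem_ball.1 hy).le) k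
  exact this.continuousAt (Metric.isOpen_ball.mem_nhds (by simp))

lemma mFourier_neg_coe {n : ℕ} (m : Fin n → ℤ) (x : Fin n → ℝ) :
    UnitAddTorus.mFourier (-m) (fun j => (x j : UnitAddCircle)) =
      Complex.exp (((-(dotp x ((2 * Real.pi) • intVec m)) : ℝ) : ℂ) * Complex.I) := by
  simp only [UnitAddTorus.mFourier, ContinuousMap.coe_mk, fourier_coe_apply, ← Complex.exp_sum]
  congr 1
  simp only [dotp, intVec, Pi.neg_apply, Pi.smul_apply, smul_eq_mul, ← Finset.sum_neg_distrib]
  push_cast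
  rw [Finset.sum_mul]
  exact Finset.sum_congr rfl fun j _ => by ring

/-- Poisson summation on `ℝⁿ`. -/
theorem HasDecay.tsum_intVec_eq {n : ℕ} {g : (Fin n → ℝ) → ℂ} (hd : HasDecay g)
    (hg : Continuous g) (hs : Summable fun k : Fin n → ℤ => FTn g ((2 * Real.pi) • intVec k)) :
    ∑' k : Fin n → ℤ, g (intVec k) = ∑' k : Fin n → ℤ, FTn g ((2 * Real.pi) • intVec k) := by
  let π : (Fin n → ℝ) → UnitAddTorus (Fin n) := fun x j => (x j : UnitAddCircle)
  have hπ : IsOpenQuotientMap π :=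
    IsOpenQuotientMap.piMap fun _ => QuotientAddGroup.isOpenQuotientMap_mk
  let P : (Fin n → ℝ) → ℂ := fun x => ∑' k, g (x + intVec k)
  have hP : Continuous P := by simpa using hd.continuous_tsum hg one_pos
  have hper : ∀ x (l : Fin n → ℤ), P (x + intVec l) = P x := fun x l => by
    refine (tsum_congr fun k => ?_).trans ((Equiv.addLeft l).tsum_eq fun k => g (x + intVec k))
    simp [intVec_add, add_assoc]
  let F₀ : UnitAddTorus (Fin n) → ℂ := fun t => P (Function.surjInv hπ.surjective t)
  have hF₀ : ∀ x, F₀ (π x) = P x := fun x => by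
    have h := Function.surjInv_eq hπ.surjective (π x)
    set y := Function.surjInv hπ.surjective (π x) with hy
    have : ∀ j, ∃ l : ℤ, y j = x j + l := fun j => by
      have hj : ((y j - x j : ℝ) : UnitAddCircle) = 0 := by
        rw [AddCircle.coe_sub, sub_eq_zero]
        exact congrFun h j
      obtain ⟨l, hl⟩ := (AddCircle.coe_eq_zero_iff 1).1 hj
      refine ⟨l, ?_⟩
      rw [zsmul_one] at hl
      linarith
    choose l hl using this
    have hyl : y = x + intVec l := funext hl
    change P y = P x
    rw [hyl, hper]
  let F : C(UnitAddTorus (Fin n), ℂ) :=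
    ⟨F₀, hπ.isQuotientMap.continuous_iff.2 (by simpa only [Function.comp_def, hF₀] using hP)⟩
  have hint : Integrable g := hd.integrable hg
  have hcoeff : ∀ m, UnitAddTorus.mFourierCoeff F m = FTn g ((2 * Real.pi) • intVec m) := fun m => by
    let e : (Fin n → ℝ) → ℂ := fun x => UnitAddTorus.mFourier (-m) (π x)
    have hec : Continuous e := (map_continuous _).comp hπ.continuous
    have hen : ∀ x, ‖e x‖ = 1 := fun x => by
      simp only [e, π, mFourier_neg_coe, Complex.norm_exp_ofReal_mul_I]
    have hep : ∀ x (k : Fin n → ℤ), e (x + intVec k) = e x := fun x k => by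
      simp only [e]
      congr 1
      ext j
      simp [π, intVec]
    have hei : Integrable fun x => e x * g x :=
      hint.bdd_mul hec.aestronglyMeasurable (.of_forall fun x => (hen x).le)
    have hsum : HasSum (fun k : Fin n → ℤ => ∫ x in unitBox n, e x * g (x + intVec k))
        (∫ x in unitBox n, ∑' k : Fin n → ℤ, e x * g (x + intVec k)) := by
      refine hasSum_integral_of_summable_integral_norm (fun k => ?_) ?_
      · have := (hei.comp_add_right (intVec k)).integrableOn (s := unitBox n)
        simpa only [hep, IntegrableOn] using this
      · simpa only [hep] using (hasSum_integral_unitBox hei.norm).summable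
    have hsum' := hasSum_integral_unitBox hei
    simp only [hep] at hsum'
    rw [UnitAddTorus.mFourierCoeff_eq_integral _ _ 0]
    calc _ = ∫ x in unitBox n, ∑' k : Fin n → ℤ, e x * g (x + intVec k) := by
          refine setIntegral_congr_fun (measurableSet_unitBox n) fun x _ => ?_
          change e x * F₀ (π x) = _
          rw [hF₀, ← tsum_mul_left]
      _ = ∫ x, e x * g x := hsum.unique hsum'
      _ = _ := by simp only [FTn, e, π, mFourier_neg_coe]
  have key := (UnitAddTorus.hasSum_mFourier_series_apply_of_summable (f := F)
    (by simpa only [funext hcoeff] using hs) (π 0)).tsum_eq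
  have h1 : ∀ m, UnitAddTorus.mFourier m (π 0) = 1 := fun m => by
    have := mFourier_neg_coe (-m) (0 : Fin n → ℝ)
    simpa [dotp, π] using this
  have h2 : F (π 0) = ∑' k : Fin n → ℤ, g (intVec k) := by
    change F₀ (π 0) = _
    rw [hF₀]
    simp [P]
  rw [← h2, ← key]
  simp only [hcoeff, h1, smul_eq_mul, mul_one]

lemma dotp_add_left {n : ℕ} (x y ξ : Fin n → ℝ) : dotp (x + y) ξ = dotp x ξ + dotp y ξ := by
  simp [dotp, add_mul, Finset.sum_add_distrib]

lemma dotp_smul_left {n : ℕ} (c : ℝ) (x ξ : Fin n → ℝ) : dotp (c • x) ξ = c * dotp x ξ := by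
  simp [dotp, Finset.mul_sum, mul_assoc]

lemma dotp_comm {n : ℕ} (x ξ : Fin n → ℝ) : dotp x ξ = dotp ξ x := by
  simp [dotp, mul_comm]

lemma dotp_add_right {n : ℕ} (x ξ η : Fin n → ℝ) : dotp x (ξ + η) = dotp x ξ + dotp x η := by
  simp only [dotp_comm x, dotp_add_left]

lemma dotp_smul_right {n : ℕ} (c : ℝ) (x ξ : Fin n → ℝ) : dotp x (c • ξ) = c * dotp x ξ := by
  simp only [dotp_comm x, dotp_smul_left]

@[fun_prop]
lemma continuous_dotp {n : ℕ} (x : Fin n → ℝ) : Continuous (dotp x) := by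
  unfold dotp; fun_prop

lemma SchwartzMap.exists_norm_le_inv_one_add_norm_pow {E : Type*} [NormedAddCommGroup E]
    [NormedSpace ℝ E] (f : SchwartzMap E ℂ) (k : ℕ) :
    ∃ C, 0 ≤ C ∧ ∀ x, ‖f x‖ ≤ C * ((1 + ‖x‖) ^ k)⁻¹ := by
  refine ⟨2 ^ k * (Finset.Iic (k, 0)).sup (fun m => SchwartzMap.seminorm ℝ m.1 m.2) f,
    by positivity, fun x => ?_⟩
  have := SchwartzMap.one_add_le_sup_seminorm_apply (𝕜 := ℝ) (m := (k, 0)) le_rfl le_rfl f x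
  rw [norm_iteratedFDeriv_zero] at this
  rw [← div_eq_mul_inv, le_div_iff₀ (by positivity), mul_comm]
  exact this

lemma SchwartzMap.hasDecay {n : ℕ} (f : SchwartzMap (Fin n → ℝ) ℂ) : HasDecay f :=
  f.exists_norm_le_inv_one_add_norm_pow (n + 1)

open scoped FourierTransform in
/-- `FTn` of a Schwartz function is, up to dilation, the Fourier transform on Euclidean space. -/
lemma FTn_eq_fourier {n : ℕ} (f : SchwartzMap (Fin n → ℝ) ℂ) (ξ : Fin n → ℝ) :
    FTn f ξ = 𝓕 (SchwartzMap.compCLMOfContinuousLinearEquiv ℂ (EuclideanSpace.equiv (Fin n) ℝ) f)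
      (WithLp.toLp 2 ((2 * Real.pi)⁻¹ • ξ)) := by
  rw [SchwartzMap.fourier_coe, Real.fourier_eq', ← (PiLp.volume_preserving_toLp
    (Fin n)).integral_comp (MeasurableEquiv.toLp 2 _).measurableEmbedding]
  refine integral_congr_ae (.of_forall fun x => ?_)
  have h : -2 * Real.pi * inner ℝ (WithLp.toLp 2 x) (WithLp.toLp 2 ((2 * Real.pi)⁻¹ • ξ)) =
      -(dotp x ξ) := by
    simp only [PiLp.inner_apply, RCLike.inner_apply, conj_trivial, Pi.smul_apply, smul_eq_mul, dotp,
      Finset.mul_sum, ← Finset.sum_neg_distrib]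
    refine Finset.sum_congr rfl fun j _ => ?_
    field_simp
  simp only [h, smul_eq_mul]
  rfl

lemma continuous_FTn {n : ℕ} (f : SchwartzMap (Fin n → ℝ) ℂ) : Continuous (FTn f) := by
  rw [funext (FTn_eq_fourier f)]
  exact (SchwartzMap.continuous _).comp ((PiLp.continuous_toLp 2 _).comp (by fun_prop))

lemma hasDecay_FTn {n : ℕ} (f : SchwartzMap (Fin n → ℝ) ℂ) : HasDecay (FTn f) := by
  obtain ⟨C, hC0, hC⟩ := SchwartzMap.exists_norm_le_inv_one_add_norm_pow
    (FourierTransform.fourier (SchwartzMap.compCLMOfContinuousLinearEquiv ℂ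
      (EuclideanSpace.equiv (Fin n) ℝ) f)) (n + 1)
  refine ⟨C * (2 * Real.pi) ^ (n + 1), by positivity, fun ξ => ?_⟩
  rw [FTn_eq_fourier, mul_assoc]
  refine (hC _).trans ?_
  gcongr
  set y : Fin n → ℝ := (2 * Real.pi)⁻¹ • ξ with hy
  have hξ : ‖ξ‖ = 2 * Real.pi * ‖y‖ := by
    rw [hy, norm_smul, Real.norm_of_nonneg (by positivity)]
    field_simp
  have hle : ‖y‖ ≤ ‖WithLp.toLp 2 y‖ :=
    (pi_norm_le_iff_of_nonneg (norm_nonneg _)).2 fun j => PiLp.norm_apply_le (WithLp.toLp 2 y) j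
  calc ((1 + ‖WithLp.toLp 2 y‖) ^ (n + 1))⁻¹ ≤ decayWeight y := by unfold decayWeight; gcongr
    _ ≤ _ := by
      refine decayWeight_le ?_
      rw [hξ]
      linarith [Real.pi_gt_three]

/-- Poisson summation for samples of a Schwartz function on the lattice `a ℤⁿ`. -/
theorem SchwartzMap.tsum_samples_eq {n : ℕ} (f : SchwartzMap (Fin n → ℝ) ℂ) {a : ℝ} (ha : 0 < a)
    (ξ : Fin n → ℝ) :
    ∑' k : Fin n → ℤ,
        Complex.exp (((-(dotp (a • intVec k) ξ) : ℝ) : ℂ) * Complex.I) * f (a • intVec k) =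
      ((a ^ n)⁻¹ : ℝ) • ∑' k : Fin n → ℤ, FTn f (ξ + (2 * Real.pi / a) • intVec k) := by
  let g : (Fin n → ℝ) → ℂ := fun y =>
    Complex.exp (((-(dotp (a • y) ξ) : ℝ) : ℂ) * Complex.I) * f (a • y)
  have hgc : Continuous g := by
    simp only [g, dotp_comm _ ξ]
    exact .mul (by fun_prop) (f.continuous.comp (by fun_prop))
  have hgd : HasDecay g := by
    obtain ⟨C, hC0, hC⟩ := f.hasDecay
    refine ⟨C * (1 + (1 + 0) / a) ^ (n + 1), by positivity, fun y => ?_⟩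
    simp only [g, norm_mul, Complex.norm_exp_ofReal_mul_I, one_mul]
    refine (hC _).trans ?_
    rw [mul_assoc]
    gcongr
    simpa using decayWeight_add_smul_le ha le_rfl (x := 0) (y := y) (by simp)
  have hg : ∀ k : Fin n → ℤ, FTn g ((2 * Real.pi) • intVec k) =
      ((a ^ n)⁻¹ : ℝ) • FTn f (ξ + (2 * Real.pi / a) • intVec k) := fun k => by
    have h := Measure.integral_comp_smul volume (fun x : Fin n → ℝ =>
      Complex.exp (((-(dotp x (ξ + (2 * Real.pi / a) • intVec k)) : ℝ) : ℂ) * Complex.I) * f x) a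
    rw [Module.finrank_fin_fun, abs_of_pos (by positivity)] at h
    rw [FTn, FTn, ← h]
    refine integral_congr_ae (.of_forall fun y => ?_)
    simp only [g]
    rw [← mul_assoc, ← Complex.exp_add, ← add_mul, ← Complex.ofReal_add]
    congr 4
    simp only [dotp_add_right, dotp_smul_right, dotp_smul_left]
    field_simp
    ring
  have hs : Summable fun k : Fin n → ℤ => FTn g ((2 * Real.pi) • intVec k) := by
    simp only [hg]
    exact ((hasDecay_FTn f).summable (by positivity) ξ).const_smul _
  rw [← tsum_const_smul'', ← funext hg]
  exact hgd.tsum_intVec_eq hgc hs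

/-- Termwise integration of `∑ₖ u k` against an integrable `W`, when the `u k` are dominated on the
support of `W` by a multiple of a summable weight. -/
lemma hasSum_integral_mul_of_bound {n : ℕ} {W : (Fin n → ℝ) → ℂ} (hW : Integrable W)
    {u : (Fin n → ℤ) → (Fin n → ℝ) → ℂ} (hu : ∀ k, Continuous (u k)) {C : ℝ}
    (hC : ∀ ξ, W ξ ≠ 0 → ∀ k, ‖u k ξ‖ ≤ C * decayWeight (intVec k)) :
    HasSum (fun k => ∫ ξ, W ξ * u k ξ) (∫ ξ, W ξ * ∑' k, u k ξ) := by
  have hb : ∀ k ξ, ‖W ξ * u k ξ‖ ≤ ‖W ξ‖ * (C * decayWeight (intVec k)) := fun k ξ => by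
    rw [norm_mul]
    by_cases h : W ξ = 0
    · simp [h]
    · gcongr
      exact hC ξ h k
  have hi : ∀ k, Integrable fun ξ => W ξ * u k ξ := fun k =>
    (hW.norm.mul_const _).mono' (hW.aestronglyMeasurable.mul (hu k).aestronglyMeasurable)
      (.of_forall (hb k))
  simp only [← tsum_mul_left]
  refine hasSum_integral_of_summable_integral_norm hi ?_
  refine .of_nonneg_of_le (fun k => by positivity) (fun k => ?_)
    ((summable_decayWeight n).mul_left ((∫ ξ, ‖W ξ‖) * C))
  rw [mul_assoc, ← integral_mul_const]
  exact integral_mono (hi k).norm (hW.norm.mul_const _) (hb k)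

lemma HasCompactSupport.integrable_of_bounded {n : ℕ} {φ : (Fin n → ℝ) → ℂ}
    (hs : HasCompactSupport φ) (hm : Measurable φ) {C : ℝ} (hb : ∀ ξ, ‖φ ξ‖ ≤ C) :
    Integrable φ := by
  rw [← integrableOn_iff_integrable_of_support_subset (subset_tsupport φ)]
  exact .of_bound hs.measure_lt_top hm.aestronglyMeasurable C (.of_forall hb)

lemma invFTn_smul_eq_integral {n : ℕ} (φ : (Fin n → ℝ) → ℂ) {a : ℝ} (ha : 0 < a)
    (y : Fin n → ℝ) :
    invFTn φ ((Real.pi / a) • y) = ((2 * Real.pi) ^ n)⁻¹ • ∫ ξ : Fin n → ℝ,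
      Complex.exp ((dotp y ξ : ℂ) * Complex.I) *
        ((Real.pi ^ n)⁻¹ • φ ((a / Real.pi) • ξ)) * ((a ^ n : ℝ) : ℂ) := by
  have h := Measure.integral_comp_smul volume (fun η : Fin n → ℝ =>
    Complex.exp ((dotp ((Real.pi / a) • y) η : ℂ) * Complex.I) * φ η) (a / Real.pi)
  have hp := Real.pi_pos
  rw [Module.finrank_fin_fun, abs_of_pos (by positivity),
    ← inv_smul_eq_iff₀ (by positivity), inv_inv] at h
  rw [invFTn, ← h, ← integral_smul]
  congr 2 with ξ
  have hd : dotp ((Real.pi / a) • y) ((a / Real.pi) • ξ) = dotp y ξ := by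
    rw [dotp_smul_left, dotp_smul_right]
    field_simp
  rw [hd, Complex.real_smul, Complex.real_smul, div_pow]
  push_cast
  ring

/-- aliasing identity. For Schwartz `f`, sampling step `a > 0`, and a bounded
compactly supported filter `χ̂` with `χ = (2π)^{−n}∫e^{ix·ξ}χ̂`, the sampling series
`Σ_k f(ak) χ(π(x−ak)/a)` equals the filtered periodization
`(2π)^{−n}∫ e^{ix·ξ} π^{−n}χ̂(aξ/π) Σ_k f̂(ξ+(2π/a)k) dξ`, and also equals
`Σ_k e^{2πik·x/a} F⁻¹[π^{−n}χ̂(a·/π + 2k) f̂](x)`. -/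
theorem stmt10 (n : ℕ) (f : SchwartzMap (Fin n → ℝ) ℂ) (a : ℝ) (ha : 0 < a)
    (χhat : (Fin n → ℝ) → ℂ) (hχm : Measurable χhat) (hχb : ∃ C, ∀ ξ, ‖χhat ξ‖ ≤ C)
    (hχs : HasCompactSupport χhat) :
    ∀ x : Fin n → ℝ,
      (∑' k : Fin n → ℤ, f (fun j => a * (k j : ℝ)) *
          invFTn χhat (fun j => Real.pi / a * (x j - a * (k j : ℝ))))
        = ((2 * Real.pi) ^ n)⁻¹ •
            (∫ ξ : Fin n → ℝ, Complex.exp ((dotp x ξ : ℂ) * Complex.I) *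
              ((Real.pi ^ n)⁻¹ • χhat ((a / Real.pi) • ξ)) *
              ∑' k : Fin n → ℤ, FTn (⇑f) (fun j => ξ j + 2 * Real.pi / a * (k j : ℝ))) ∧
      (∑' k : Fin n → ℤ, f (fun j => a * (k j : ℝ)) *
          invFTn χhat (fun j => Real.pi / a * (x j - a * (k j : ℝ))))
        = ∑' k : Fin n → ℤ,
            Complex.exp (((2 * Real.pi * (∑ j, (k j : ℝ) * x j) / a : ℝ) : ℂ) * Complex.I) *
              invFTn (fun ξ => (Real.pi ^ n)⁻¹ •
                (χhat (fun j => a * ξ j / Real.pi + 2 * (k j : ℝ)) * FTn (⇑f) ξ)) x := by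
  intro x
  obtain ⟨C, hC⟩ := hχb
  have hp := Real.pi_pos
  have hap : a / Real.pi ≠ 0 := by positivity
  let W : (Fin n → ℝ) → ℂ := fun ξ => Complex.exp ((dotp x ξ : ℂ) * Complex.I) *
    ((Real.pi ^ n)⁻¹ • χhat ((a / Real.pi) • ξ))
  have hχi : Integrable fun ξ => χhat ((a / Real.pi) • ξ) :=
    (hχs.integrable_of_bounded hχm hC).comp_smul hap
  have hWi : Integrable W :=
    (hχi.smul (Real.pi ^ n)⁻¹).bdd_mul (c := 1)
      (Continuous.aestronglyMeasurable (by fun_prop))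
      (.of_forall fun ξ => (Complex.norm_exp_ofReal_mul_I _).le)
  obtain ⟨R, hR0, hR⟩ : ∃ R, 0 ≤ R ∧ ∀ ξ, W ξ ≠ 0 → ‖ξ‖ ≤ R := by
    obtain ⟨R, hR⟩ := (hχs.comp_smul hap).isBounded.exists_norm_le
    refine ⟨max R 0, le_max_right _ _, fun ξ hξ => (hR ξ (subset_tsupport _ ?_)).trans
      (le_max_left _ _)⟩
    rw [Function.mem_support]
    exact right_ne_zero_of_smul (right_ne_zero_of_mul hξ)
  let c : ℝ := 2 * Real.pi / a
  have hc : 0 < c := by positivity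
  obtain ⟨B, -, hB⟩ := (hasDecay_FTn f).exists_bound hc hR0
  obtain ⟨D, -, hD⟩ := f.hasDecay.exists_bound ha le_rfl
  have hspec := hasSum_integral_mul_of_bound hWi (u := fun k ξ => FTn f (ξ + c • intVec k))
    (fun k => (continuous_FTn f).comp (by fun_prop)) fun ξ hξ => hB ξ (hR ξ hξ)
  have hsamp := hasSum_integral_mul_of_bound hWi (C := a ^ n * D) (u := fun k ξ =>
      ((a ^ n : ℝ) : ℂ) * (Complex.exp (((-(dotp (a • intVec k) ξ) : ℝ) : ℂ) * Complex.I) *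
        f (a • intVec k))) (fun k => by fun_prop) fun ξ _ k => by
    rw [norm_mul, norm_mul, Complex.norm_exp_ofReal_mul_I, one_mul, Complex.norm_real,
      Real.norm_of_nonneg (by positivity), mul_assoc]
    gcongr
    simpa using hD 0 (by simp) k
  have hfold : ∀ ξ, ∑' k : Fin n → ℤ, ((a ^ n : ℝ) : ℂ) *
      (Complex.exp (((-(dotp (a • intVec k) ξ) : ℝ) : ℂ) * Complex.I) * f (a • intVec k)) =
      ∑' k : Fin n → ℤ, FTn f (ξ + c • intVec k) := fun ξ => by
    rw [tsum_mul_left, f.tsum_samples_eq ha, ← Complex.real_smul, smul_smul,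
      mul_inv_cancel₀ (by positivity), one_smul]
  simp only [hfold] at hsamp
  have hleft : ∀ k : Fin n → ℤ, f (fun j => a * (k j : ℝ)) *
      invFTn χhat (fun j => Real.pi / a * (x j - a * (k j : ℝ))) =
      ((2 * Real.pi) ^ n)⁻¹ • ∫ ξ, W ξ * (((a ^ n : ℝ) : ℂ) *
        (Complex.exp (((-(dotp (a • intVec k) ξ) : ℝ) : ℂ) * Complex.I) *
          f (a • intVec k))) := fun k => by
    have h := invFTn_smul_eq_integral χhat ha (x + (-a) • intVec k)
    have hy : (Real.pi / a) • (x + (-a) • intVec k) =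
        fun j => Real.pi / a * (x j - a * (k j : ℝ)) := by
      ext j; simp [intVec, sub_eq_add_neg]
    rw [hy] at h
    rw [h, mul_smul_comm, ← integral_const_mul]
    congr 2 with ξ
    rw [dotp_add_left, dotp_smul_left, dotp_smul_left, Complex.ofReal_add, add_mul,
      Complex.exp_add, ← neg_mul]
    change f (a • intVec k) * _ = _
    simp only [W]
    ring
  have hright : ∀ k : Fin n → ℤ,
      Complex.exp (((2 * Real.pi * (∑ j, (k j : ℝ) * x j) / a : ℝ) : ℂ) * Complex.I) *
        invFTn (fun ξ => (Real.pi ^ n)⁻¹ •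
          (χhat (fun j => a * ξ j / Real.pi + 2 * (k j : ℝ)) * FTn (⇑f) ξ)) x =
      ((2 * Real.pi) ^ n)⁻¹ • ∫ ξ, W ξ * FTn f (ξ + c • intVec (-k)) := fun k => by
    rw [invFTn, mul_smul_comm, ← integral_const_mul,
      ← integral_add_right_eq_self (fun ξ => W ξ * FTn f (ξ + c • intVec (-k))) (c • intVec k)]
    congr 2 with ξ
    have h1 : ξ + c • intVec k + c • intVec (-k) = ξ := by
      ext j; simp [intVec]
    have h2 : (a / Real.pi) • (ξ + c • intVec k) =
        fun j => a * ξ j / Real.pi + 2 * (k j : ℝ) := by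
      ext j
      simp only [intVec, c, Pi.smul_apply, Pi.add_apply, smul_eq_mul]
      field_simp
    have h3 : dotp x (ξ + c • intVec k) =
        2 * Real.pi * (∑ j, (k j : ℝ) * x j) / a + dotp x ξ := by
      rw [dotp_add_right, dotp_smul_right, dotp_comm x (intVec k)]
      simp only [dotp, intVec, c]
      ring
    simp only [W]
    rw [h1, h2, h3, Complex.ofReal_add, add_mul, Complex.exp_add, Complex.real_smul,
      Complex.real_smul]
    ring
  have hmid : (∑' k : Fin n → ℤ, f (fun j => a * (k j : ℝ)) *
      invFTn χhat (fun j => Real.pi / a * (x j - a * (k j : ℝ)))) =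
      ((2 * Real.pi) ^ n)⁻¹ • ∫ ξ, W ξ * ∑' k : Fin n → ℤ, FTn f (ξ + c • intVec k) := by
    rw [tsum_congr hleft, tsum_const_smul'', hsamp.tsum_eq]
  refine ⟨hmid, hmid.trans ?_⟩
  rw [tsum_congr hright, tsum_const_smul'', ← hspec.tsum_eq]
  congr 1
  exact ((Equiv.neg _).tsum_eq fun k => ∫ ξ, W ξ * FTn f (ξ + c • intVec k)).symm
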